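/- arXiv:0909.4577 — 4 statements merged into one kernel-verified Lean document; each statement's English description precedes it below -/
import Mathlib

section
/- For every integer m ≥ 3, one has m + 4/√6 − 3/2 > (m+1)/√(m+4) + 1/√(m+3) + (m−3)/√3 + 1. -/
/-- For every integer `m ≥ 3`,
`m + 4/√6 − 3/2 > (m+1)/√(m+4) + 1/√(m+3) + (m−3)/√3 + 1`. -/
theorem stmt_0 (m : ℤ) (hm : 3 ≤ m) :
    (m : ℝ) + 4 / Real.sqrt 6 - 3 / 2 >
      ((m : ℝ) + 1) / Real.sqrt ((m : ℝ) + 4) + 1 / Real.sqrt ((m : ℝ) + 3) +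
        ((m : ℝ) - 3) / Real.sqrt 3 + 1 := by
  have hx : (3 : ℝ) ≤ m := by exact_mod_cast hm
  generalize (m : ℝ) = x at hx ⊢
  obtain ⟨t, ht, rfl⟩ : ∃ t : ℝ, 0 ≤ t ∧ x = t + 3 := ⟨x - 3, by linarith, by ring⟩
  have h₁ : (1.63 : ℝ) ≤ 4 / √6 := by
    have h : √6 ≤ 2.45 := Real.sqrt_le_iff.2 (by norm_num)
    rw [le_div_iff₀ (by positivity)]
    linarith
  have h₂ : 1 / √(t + 3 + 3) ≤ 0.42 := by
    have h : (2.4 : ℝ) ≤ √(t + 3 + 3) := Real.le_sqrt_of_sq_le (by linarith)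
    rw [div_le_iff₀ (by linarith)]
    linarith
  have h₃ : (t + 3 - 3) / √3 ≤ 0.6 * t := by
    have h : (1.7 : ℝ) ≤ √3 := Real.le_sqrt_of_sq_le (by norm_num)
    rw [div_le_iff₀ (by linarith)]
    nlinarith
  -- The tangent-like linear bound for the concave function `(x + 1) / √(x + 4)`.
  have h₄ : (t + 3 + 1) / √(t + 3 + 4) ≤ 1.55 + 0.3 * t := by
    rw [div_le_iff₀ (by positivity)]
    refine (sq_le_sq₀ (by positivity) (by positivity)).1 ?_
    rw [mul_pow, Real.sq_sqrt (by positivity)]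
    nlinarith [pow_nonneg ht 2, pow_nonneg ht 3]
  linarith
end

section
/- For every integer m ≥ 5, one has (1/2 + 1/√6)·m − 1/2 − 2/√6 + √2 > (m+1)/√(m+4) + 1/√(m+3) + (m−3)/√3 + 1. -/
/-- The tangent-line bound at `x = 5` for the concave function `(x + 1) / √(x + 4)`. -/
theorem add_one_div_sqrt_add_four_le {x : ℝ} (hx : -4 < x) :
    (x + 1) / Real.sqrt (x + 4) ≤ 2 / 9 * (x + 4) := by
  have hs : 0 < Real.sqrt (x + 4) := Real.sqrt_pos.2 (by linarith)
  have hsq : Real.sqrt (x + 4) ^ 2 = x + 4 := Real.sq_sqrt (by linarith)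
  rw [div_le_iff₀ hs]
  generalize Real.sqrt (x + 4) = s at hs hsq ⊢
  obtain rfl : x = s ^ 2 - 4 := by linarith
  have key := mul_nonneg (sq_nonneg (s - 3)) (by linarith : 0 ≤ 2 * s + 3)
  linarith

/-- For every integer `m ≥ 5`,
`(1/2 + 1/√6)·m − 1/2 − 2/√6 + √2 > (m+1)/√(m+4) + 1/√(m+3) + (m−3)/√3 + 1`. -/
theorem stmt_1 (m : ℤ) (hm : 5 ≤ m) :
    (1 / 2 + 1 / Real.sqrt 6) * (m : ℝ) - 1 / 2 - 2 / Real.sqrt 6 + Real.sqrt 2 >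
      ((m : ℝ) + 1) / Real.sqrt ((m : ℝ) + 4) + 1 / Real.sqrt ((m : ℝ) + 3) +
        ((m : ℝ) - 3) / Real.sqrt 3 + 1 := by
  have hx : (5 : ℝ) ≤ m := by exact_mod_cast hm
  generalize (m : ℝ) = x at hx ⊢
  have h₁ := add_one_div_sqrt_add_four_le (x := x) (by linarith)
  have h₂ : 1 / Real.sqrt (x + 3) ≤ 1 / 2.8 :=
    one_div_le_one_div_of_le (by norm_num) (Real.le_sqrt_of_sq_le (by norm_num; linarith))
  have h₃ : (1.414 : ℝ) ≤ Real.sqrt 2 := Real.le_sqrt_of_sq_le (by norm_num)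
  have h₄ : 0.408 ≤ 1 / Real.sqrt 6 := by
    rw [le_div_iff₀ (by positivity)]
    have : Real.sqrt 6 ≤ 2.45 := Real.sqrt_le_iff.2 (by norm_num)
    linarith
  have h₅ : 1 / Real.sqrt 3 ≤ 0.5775 := by
    rw [div_le_iff₀ (by positivity)]
    have : (1.732 : ℝ) ≤ Real.sqrt 3 := Real.le_sqrt_of_sq_le (by norm_num)
    linarith
  have h₆ := mul_le_mul_of_nonneg_left h₄ (by linarith : 0 ≤ x - 2)
  have h₇ := mul_le_mul_of_nonneg_left h₅ (by linarith : 0 ≤ x - 3)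
  have h₈ : (x - 3) / Real.sqrt 3 = (x - 3) * (1 / Real.sqrt 3) := by ring
  have h₉ : 2 / Real.sqrt 6 = 2 * (1 / Real.sqrt 6) := by ring
  rw [h₈, h₉]
  norm_num at h₂ h₃ h₆ h₇ ⊢
  linarith
end

section
/- For every integer m ≥ 3, one has −(m+1)/√(m+4) + (m−1)/√(m+3) + 1/√(m+2) ≥ −4/√7 + 2/√6 + 1/√5, with equality if and only if m = 3. -/
/-- The graph of `1 / √·` lies above its tangent line, in terms of square roots. -/
theorem inv_ge_tangent {b y : ℝ} (hb : 0 < b) (hy : 0 < y) :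
    1 / b - (y ^ 2 - b ^ 2) / 2 * (1 / b) ^ 3 ≤ 1 / y := by
  have h : 1 / y - (1 / b - (y ^ 2 - b ^ 2) / 2 * (1 / b) ^ 3) =
      (y - b) ^ 2 * (y + 2 * b) / (2 * b ^ 3 * y) := by
    field_simp
    ring
  have h' : 0 ≤ (y - b) ^ 2 * (y + 2 * b) / (2 * b ^ 3 * y) := by positivity
  linarith

/-- The graph of `√·` lies below its tangent line, in terms of square roots. -/
theorem le_tangent {b y : ℝ} (hb : 0 < b) :
    y ≤ b + (y ^ 2 - b ^ 2) / 2 * (1 / b) := by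
  have h : b + (y ^ 2 - b ^ 2) / 2 * (1 / b) - y = (y - b) ^ 2 / (2 * b) := by
    field_simp
    ring
  have h' : 0 ≤ (y - b) ^ 2 / (2 * b) := by positivity
  linarith

theorem value_at_three_lt :
    -4 / Real.sqrt 7 + 2 / Real.sqrt 6 + 1 / Real.sqrt 5 < -0.248 := by
  have h7 : Real.sqrt 7 ≤ 2.64576 := Real.sqrt_le_iff.2 (by norm_num)
  have h6 : 2.44948 ≤ Real.sqrt 6 := Real.le_sqrt_of_sq_le (by norm_num)
  have h5 : 2.23606 ≤ Real.sqrt 5 := Real.le_sqrt_of_sq_le (by norm_num)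
  have h7' : 4 / 2.64576 ≤ 4 / Real.sqrt 7 := by gcongr
  have h6' : 2 / Real.sqrt 6 ≤ 2 / 2.44948 := by gcongr
  have h5' : 1 / Real.sqrt 5 ≤ 1 / 2.23606 := by gcongr
  rw [neg_div]
  norm_num at h7' h6' h5' ⊢
  linarith

theorem lt_value_of_four_le {x : ℝ} (hx : 4 ≤ x) :
    -0.248 < -(x + 1) / Real.sqrt (x + 4) + (x - 1) / Real.sqrt (x + 3) +
      1 / Real.sqrt (x + 2) := by
  have ha : 0 < Real.sqrt (x + 2) := Real.sqrt_pos.2 (by linarith)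
  have hc : 0 < Real.sqrt (x + 4) := Real.sqrt_pos.2 (by linarith)
  have hb : 2.6457 ≤ Real.sqrt (x + 3) := Real.le_sqrt_of_sq_le (by norm_num; linarith)
  have ha2 : Real.sqrt (x + 2) ^ 2 = x + 2 := Real.sq_sqrt (by linarith)
  have hb2 : Real.sqrt (x + 3) ^ 2 = x + 3 := Real.sq_sqrt (by linarith)
  have hc2 : Real.sqrt (x + 4) ^ 2 = x + 4 := Real.sq_sqrt (by linarith)
  generalize Real.sqrt (x + 2) = a at *
  generalize Real.sqrt (x + 3) = b at *
  generalize Real.sqrt (x + 4) = c at *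
  have hb0 : 0 < b := by linarith
  have hac := inv_ge_tangent hb0 ha
  have hcc := inv_ge_tangent hb0 hc
  have hcb := le_tangent (y := c) hb0
  rw [show a ^ 2 - b ^ 2 = -1 by linarith] at hac
  rw [show c ^ 2 - b ^ 2 = 1 by linarith] at hcc hcb
  have e1 : -(x + 1) / c = 3 * (1 / c) - c := by
    rw [show x = c ^ 2 - 4 by linarith]
    field_simp
    ring
  have e2 : (x - 1) / b = b - 4 * (1 / b) := by
    rw [show x = b ^ 2 - 3 by linarith]
    field_simp
    ring
  have ht : 1 / b ≤ 0.378 := by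
    rw [div_le_iff₀ hb0]
    linarith
  have ht3 : (1 / b) ^ 3 ≤ 0.378 ^ 3 := by gcongr
  rw [e1, e2]
  norm_num at ht3 ht hac hcc hcb ⊢
  linarith


/-- For every integer `m ≥ 3`,
`−(m+1)/√(m+4) + (m−1)/√(m+3) + 1/√(m+2) ≥ −4/√7 + 2/√6 + 1/√5`,
with equality if and only if `m = 3`. -/
theorem stmt_2 (m : ℤ) (hm : 3 ≤ m) :
    (-((m : ℝ) + 1) / Real.sqrt ((m : ℝ) + 4) + ((m : ℝ) - 1) / Real.sqrt ((m : ℝ) + 3) +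
        1 / Real.sqrt ((m : ℝ) + 2) ≥
      -4 / Real.sqrt 7 + 2 / Real.sqrt 6 + 1 / Real.sqrt 5) ∧
    ((-((m : ℝ) + 1) / Real.sqrt ((m : ℝ) + 4) + ((m : ℝ) - 1) / Real.sqrt ((m : ℝ) + 3) +
        1 / Real.sqrt ((m : ℝ) + 2) =
      -4 / Real.sqrt 7 + 2 / Real.sqrt 6 + 1 / Real.sqrt 5) ↔ m = 3) := by
  rcases hm.eq_or_lt with rfl | h
  · norm_num
  · have hlt := value_at_three_lt.trans
      (lt_value_of_four_le (x := (m : ℝ)) (by exact_mod_cast h))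
    exact ⟨hlt.le, fun he => absurd he hlt.ne', fun he => absurd he h.ne'⟩
end

section
/- Let G be a bicyclic graph with 2m vertices and matching number m (i.e., G has a perfect matching), where m ≥ 3, and suppose that no pendent vertex of G has a neighbor of degree two. Then χ(G) ≥ (m+1)/√(m+4) + 1/√(m+3) + (m−3)/√3 + 1, with equality if and only if m = 3 and G is isomorphic to B_{6,3}. -/
open SimpleGraph

/-- The degree of a vertex (stated via `Set.ncard`, so no decidability assumptions). -/
noncomputable def degR {V : Type*} (G : SimpleGraph V) (v : V) : ℕ :=
  (G.neighborSet v).ncard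

/-- The sum-connectivity index `χ(G) = ∑_{uv ∈ E(G)} 1/√(d_G(u)+d_G(v))`. -/
noncomputable def sumConn {V : Type*} [Fintype V] (G : SimpleGraph V) : ℝ :=
  ∑ e ∈ G.edgeSet.toFinite.toFinset,
    Sym2.lift ⟨fun u v => (1 : ℝ) / Real.sqrt ((degR G u : ℝ) + (degR G v : ℝ)),
      fun u v => by simp [add_comm]⟩ e

/-- The matching number: the maximum size of a set of pairwise non-adjacent edges. -/
noncomputable def matchingNumber {V : Type*} (G : SimpleGraph V) : ℕ :=
  sSup {k | ∃ M : Set (Sym2 V), M ⊆ G.edgeSet ∧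
    M.Pairwise (fun e f => ∀ v, v ∈ e → v ∉ f) ∧ M.ncard = k}

/-- Vertex type of the graph `B_{n,m}`. -/
def BnmVert (n m : ℕ) : Type := Unit ⊕ Fin 4 ⊕ Fin (n - 2 * m + 1) ⊕ (Fin (m - 3) × Fin 2)

instance (n m : ℕ) : Fintype (BnmVert n m) := by unfold BnmVert; infer_instance

def BnmRel (n m : ℕ) : BnmVert n m → BnmVert n m → Prop
  | Sum.inl _, Sum.inr (Sum.inl _) => True
  | Sum.inl _, Sum.inr (Sum.inr (Sum.inl _)) => True
  | Sum.inl _, Sum.inr (Sum.inr (Sum.inr (_, j))) => j = 0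
  | Sum.inr (Sum.inl i), Sum.inr (Sum.inl i') => (i = 0 ∧ i' = 1) ∨ (i = 2 ∧ i' = 3)
  | Sum.inr (Sum.inr (Sum.inr (k, j))), Sum.inr (Sum.inr (Sum.inr (k', j'))) =>
      k = k' ∧ j = 0 ∧ j' = 1
  | _, _ => False

/-- The graph `B_{n,m}`: two triangles sharing a common vertex (`Sum.inl ()`), with
`n - 2m + 1` pendent vertices and `m - 3` paths on two vertices attached to the
common vertex. -/
def BnmGraph (n m : ℕ) : SimpleGraph (BnmVert n m) := SimpleGraph.fromRel (BnmRel n m)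

lemma degR_iso {V W : Type*} {G : SimpleGraph V} {H : SimpleGraph W} (φ : G ≃g H) (v : V) :
    degR H (φ v) = degR G v := by
  have h : H.neighborSet (φ v) = φ '' G.neighborSet v := by
    ext w
    constructor
    · intro hw
      refine ⟨φ.symm w, ?_, by simp⟩
      rw [mem_neighborSet] at *
      rw [← φ.map_adj_iff]
      simpa using hw
    · rintro ⟨x, hx, rfl⟩
      exact φ.map_adj_iff.2 hx
  rw [degR, degR, h, Set.ncard_image_of_injective _ φ.injective]

section DartSums

variable {V : Type*} [Fintype V] (G : SimpleGraph V)

open Classical in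
lemma sum_sum_adj_eq_two_mul (F : Sym2 V → ℝ) :
    ∑ u, ∑ v, (if G.Adj u v then F s(u, v) else 0) =
      2 * ∑ e ∈ G.edgeSet.toFinite.toFinset, F e := by
  have h1 : ∑ d : G.Dart, F d.edge = 2 * ∑ e ∈ G.edgeSet.toFinite.toFinset, F e := by
    rw [← Finset.sum_fiberwise_of_maps_to (s := Finset.univ)
      (t := G.edgeSet.toFinite.toFinset) (g := fun d : G.Dart => d.edge)
      (fun d _ => by simp), Finset.mul_sum]
    refine Finset.sum_congr rfl fun e he => ?_
    rw [Finset.sum_congr rfl (g := fun _ => F e)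
      (fun d hd => by rw [(Finset.mem_filter.1 hd).2]), Finset.sum_const,
      G.dart_edge_fiber_card e (by simpa using he)]
    simp
  rw [← h1, ← Finset.sum_product', ← Finset.sum_filter]
  symm
  refine Finset.sum_bij' (fun d _ => (d.fst, d.snd))
    (fun p hp => (⟨p, (Finset.mem_filter.1 hp).2⟩ : G.Dart)) ?_ ?_ ?_ ?_ ?_
  · simp
  · simp
  · simp
  · simp
  · intro d _; rfl

open Classical in
lemma two_mul_sumConn :
    2 * sumConn G = ∑ u, ∑ v, (if G.Adj u v then
      (1 : ℝ) / Real.sqrt ((degR G u : ℝ) + (degR G v : ℝ)) else 0) := by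
  rw [sumConn, ← sum_sum_adj_eq_two_mul]
  rfl

open Classical in
lemma sumConn_iso {W : Type*} [Fintype W] {H : SimpleGraph W} (φ : G ≃g H) :
    sumConn G = sumConn H := by
  have h : 2 * sumConn G = 2 * sumConn H := by
    rw [two_mul_sumConn, two_mul_sumConn]
    refine Fintype.sum_equiv φ.toEquiv _ _ fun u => Fintype.sum_equiv φ.toEquiv _ _ fun v => ?_
    change _ = if H.Adj (φ u) (φ v) then (1 : ℝ) / Real.sqrt ((degR H (φ u) : ℝ) +
      (degR H (φ v) : ℝ)) else 0
    simp [degR_iso, φ.map_adj_iff]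
  linarith

end DartSums

section ExtremalModel

/-- A model of `B_{6,3}` on `Fin 6`: centre `0`, triangles `0 1 2` and `0 3 4`, pendent vertex
`5`. -/
def modelAdj (i j : Fin 6) : Prop :=
  i ≠ j ∧ (i = 0 ∨ j = 0 ∨ (i = 1 ∧ j = 2) ∨ (i = 2 ∧ j = 1) ∨ (i = 3 ∧ j = 4) ∨
    (i = 4 ∧ j = 3))

instance : DecidableRel modelAdj := fun i j => by unfold modelAdj; infer_instance

/-- The graph on `Fin 6` with adjacency `modelAdj`. -/
def modelGraph : SimpleGraph (Fin 6) where
  Adj := modelAdj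
  symm := ⟨by decide⟩
  loopless := ⟨by decide⟩

instance : DecidableRel modelGraph.Adj := fun i j => inferInstanceAs (Decidable (modelAdj i j))

lemma degR_eq_degree {V : Type*} [Fintype V] (G : SimpleGraph V) [DecidableRel G.Adj] (v : V) :
    degR G v = G.degree v := by
  rw [degR, Set.ncard_eq_toFinset_card', ← card_neighborSet_eq_degree, Set.toFinset_card]

lemma sumConn_modelGraph :
    sumConn modelGraph = 4 / Real.sqrt 7 + 1 / Real.sqrt 6 + 1 := by
  have hd : ∀ i, degR modelGraph i = ![5, 2, 2, 2, 2, 1] i := by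
    intro i
    rw [degR_eq_degree]
    revert i
    decide
  have h0 : degR modelGraph 0 = 5 := hd 0
  have h1 : degR modelGraph 1 = 2 := hd 1
  have h2 : degR modelGraph 2 = 2 := hd 2
  have h3 : degR modelGraph 3 = 2 := hd 3
  have h4 : degR modelGraph 4 = 2 := hd 4
  have h5 : degR modelGraph 5 = 1 := hd 5
  have hs : Real.sqrt 4 = 2 := by
    rw [show (4 : ℝ) = 2 ^ 2 by norm_num, Real.sqrt_sq (by norm_num)]
  have h := two_mul_sumConn modelGraph
  have ha : ∀ i j, modelGraph.Adj i j ↔ modelAdj i j := fun _ _ => Iff.rfl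
  simp only [h0, h1, h2, h3, h4, h5, ha, Fin.sum_univ_six, modelAdj] at h
  norm_num [Fin.ext_iff, hs] at h
  simp only [div_eq_mul_inv]
  linarith

/-- The vertices of `B_{6,3}`, numbered as in `modelGraph`. -/
def modelIndex : BnmVert 6 3 → Fin 6
  | Sum.inl _ => 0
  | Sum.inr (Sum.inl i) => ![1, 2, 3, 4] i
  | Sum.inr (Sum.inr (Sum.inl _)) => 5
  | Sum.inr (Sum.inr (Sum.inr (k, _))) => k.elim0

lemma card_bnmVert : Fintype.card (BnmVert 6 3) = 6 := by
  change Fintype.card (Unit ⊕ Fin 4 ⊕ Fin (6 - 2 * 3 + 1) ⊕ (Fin (3 - 3) × Fin 2)) = 6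
  simp

lemma modelIndex_bijective : Function.Bijective modelIndex := by
  rw [Fintype.bijective_iff_surjective_and_card]
  refine ⟨fun i => ?_, by simp [card_bnmVert]⟩
  fin_cases i
  · exact ⟨Sum.inl (), rfl⟩
  · exact ⟨Sum.inr (Sum.inl 0), rfl⟩
  · exact ⟨Sum.inr (Sum.inl 1), rfl⟩
  · exact ⟨Sum.inr (Sum.inl 2), rfl⟩
  · exact ⟨Sum.inr (Sum.inl 3), rfl⟩
  · exact ⟨Sum.inr (Sum.inr (Sum.inl 0)), rfl⟩

lemma modelAdj_modelIndex (x y : BnmVert 6 3) :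
    modelAdj (modelIndex x) (modelIndex y) ↔ (BnmGraph 6 3).Adj x y := by
  have hne : x ≠ y ↔ modelIndex x ≠ modelIndex y := modelIndex_bijective.1.ne_iff.symm
  rw [BnmGraph, fromRel_adj, hne]
  rcases x with _ | i | i | ⟨k, _⟩
  · rcases y with _ | j | j | ⟨k, _⟩
    · simp [modelAdj]
    · fin_cases j <;> simp [modelAdj, modelIndex, BnmRel]
    · simp [modelAdj, modelIndex, BnmRel]
    · exact k.elim0
  · rcases y with _ | j | j | ⟨k, _⟩
    · fin_cases i <;> simp [modelAdj, modelIndex, BnmRel]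
    · fin_cases i <;> fin_cases j <;> simp [modelAdj, modelIndex, BnmRel]
    · fin_cases i <;> simp [modelAdj, modelIndex, BnmRel]
    · exact k.elim0
  · rcases y with _ | j | j | ⟨k, _⟩
    · simp [modelAdj, modelIndex, BnmRel]
    · fin_cases j <;> simp [modelAdj, modelIndex, BnmRel]
    · simp [modelAdj, modelIndex]
    · exact k.elim0
  · exact k.elim0

/-- `B_{6,3}` is isomorphic to `modelGraph`. -/
noncomputable def bnmIsoModel : BnmGraph 6 3 ≃g modelGraph where
  toEquiv := Equiv.ofBijective modelIndex modelIndex_bijective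
  map_rel_iff' := by
    intro x y
    exact modelAdj_modelIndex x y

end ExtremalModel

lemma exists_matching_involution {V : Type*} [Fintype V] (G : SimpleGraph V) (m : ℕ)
    (hcard : Fintype.card V = 2 * m) (hmatch : matchingNumber G = m) :
    ∃ σ : V → V, (∀ v, G.Adj v (σ v)) ∧ ∀ v, σ (σ v) = v := by
  classical
  have hmem : matchingNumber G ∈ {k | ∃ M : Set (Sym2 V), M ⊆ G.edgeSet ∧
      M.Pairwise (fun e f => ∀ v, v ∈ e → v ∉ f) ∧ M.ncard = k} := by
    refine Nat.sSup_mem ⟨0, ∅, by simp⟩ ⟨(Set.univ : Set (Sym2 V)).ncard, ?_⟩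
    rintro k ⟨M, -, -, rfl⟩
    exact Set.ncard_le_ncard (Set.subset_univ _) (Set.toFinite _)
  rw [hmatch] at hmem
  obtain ⟨M, hM, hdisj, hMcard⟩ := hmem
  have hcover : M.toFinset.biUnion Sym2.toFinset = Finset.univ := by
    apply Finset.eq_univ_of_card
    rw [Finset.card_biUnion, Finset.sum_congr rfl (g := fun _ => 2), Finset.sum_const,
      ← Set.ncard_eq_toFinset_card', hMcard, hcard, smul_eq_mul, mul_comm]
    · intro e he
      exact Sym2.card_toFinset_of_not_isDiag e
        (G.not_isDiag_of_mem_edgeSet (hM (by simpa using he)))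
    · intro e he f hf hne
      refine Finset.disjoint_left.2 ?_
      intro v hv
      simpa using hdisj (by simpa using he) (by simpa using hf) hne v (by simpa using hv)
  have hex : ∀ v, ∃ w, s(v, w) ∈ M := by
    intro v
    have hv : v ∈ M.toFinset.biUnion Sym2.toFinset := hcover ▸ Finset.mem_univ v
    simp only [Finset.mem_biUnion, Set.mem_toFinset, Sym2.mem_toFinset] at hv
    obtain ⟨e, he, hve⟩ := hv
    obtain ⟨w, rfl⟩ := hve
    exact ⟨w, he⟩
  choose σ hσ using hex
  refine ⟨σ, fun v => hM (hσ v), fun v => ?_⟩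
  by_contra hne
  refine hdisj (hσ v) (hσ (σ v)) ?_ (σ v) (by simp) (by simp)
  intro h
  rw [Sym2.eq_swap, Sym2.congr_right] at h
  exact hne h.symm

lemma eq_of_adj_of_degR_eq_one {V : Type*} {G : SimpleGraph V} {u v w : V} (hu : degR G u = 1) (hv : G.Adj u v)
    (hw : G.Adj u w) : v = w := by
  obtain ⟨x, hx⟩ := Set.ncard_eq_one.1 hu
  have h1 : v ∈ G.neighborSet u := hv
  have h2 : w ∈ G.neighborSet u := hw
  rw [hx] at h1 h2
  exact h1.trans h2.symm

section Core

variable {V : Type*} [Fintype V] (G : SimpleGraph V)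

open Classical in
/-- The number of pendent neighbours of `v`. -/
noncomputable def pendCount (v : V) : ℕ :=
  (Finset.univ.filter fun u => G.Adj v u ∧ degR G u = 1).card

open Classical in
/-- The number of non-pendent neighbours of `v`. -/
noncomputable def coreCount (v : V) : ℕ :=
  (Finset.univ.filter fun u => G.Adj v u ∧ degR G u ≠ 1).card

open Classical in
/-- The set of non-pendent vertices. -/
noncomputable def coreVerts : Finset V :=
  Finset.univ.filter fun v => degR G v ≠ 1

variable {G}

lemma mem_coreVerts {v : V} : v ∈ coreVerts G ↔ degR G v ≠ 1 := by
  simp [coreVerts]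

open Classical in
lemma degR_eq_card_filter (v : V) :
    degR G v = (Finset.univ.filter fun u => G.Adj v u).card := by
  rw [degR, Set.ncard_eq_toFinset_card']
  congr 1
  ext u
  simp

open Classical in
lemma degR_eq_pendCount_add_coreCount (v : V) :
    degR G v = pendCount G v + coreCount G v := by
  rw [degR_eq_card_filter, pendCount, coreCount, ← Finset.filter_filter, ← Finset.filter_filter,
    Finset.card_filter_add_card_filter_not]

lemma one_le_degR_of_adj {u v : V} (h : G.Adj u v) : 1 ≤ degR G u :=
  (Set.ncard_pos (Set.toFinite _)).2 ⟨v, h⟩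

lemma degR_ne_one_of_adj (hconn : G.Connected) (hcard : 2 < Fintype.card V) {u v : V}
    (h : G.Adj u v) (hu : degR G u = 1) : degR G v ≠ 1 := by
  classical
  intro hv
  have hall : ∀ w, w = u ∨ w = v := by
    intro w
    obtain ⟨p⟩ := hconn.preconnected w u
    induction p with
    | nil => exact Or.inl rfl
    | cons hadj p ih =>
      rcases ih h hu with rfl | rfl
      · exact Or.inr (eq_of_adj_of_degR_eq_one hu hadj.symm h)
      · exact Or.inl (eq_of_adj_of_degR_eq_one hv hadj.symm h.symm)
  have hle : (Finset.univ : Finset V).card ≤ ({u, v} : Finset V).card :=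
    Finset.card_le_card fun w _ => by simpa using hall w
  have := Finset.card_le_two (a := u) (b := v)
  rw [Finset.card_univ] at hle
  omega

lemma pendCount_eq_zero (hconn : G.Connected) (hcard : 2 < Fintype.card V) {u : V}
    (hu : degR G u = 1) : pendCount G u = 0 := by
  classical
  rw [pendCount, Finset.card_eq_zero, Finset.filter_eq_empty_iff]
  rintro v - ⟨h, hv⟩
  exact degR_ne_one_of_adj hconn hcard h hu hv

lemma pendCount_le_one {σ : V → V} (hadj : ∀ v, G.Adj v (σ v)) (hinv : ∀ v, σ (σ v) = v)
    (v : V) : pendCount G v ≤ 1 := by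
  classical
  rw [pendCount, Finset.card_le_one]
  intro a ha b hb
  simp only [Finset.mem_filter, Finset.mem_univ, true_and] at ha hb
  have h1 := eq_of_adj_of_degR_eq_one ha.2 (hadj a) ha.1.symm
  have h2 := eq_of_adj_of_degR_eq_one hb.2 (hadj b) hb.1.symm
  rw [← hinv a, ← hinv b, h1, h2]

lemma two_le_coreCount {σ : V → V} (hadj : ∀ v, G.Adj v (σ v)) (hinv : ∀ v, σ (σ v) = v)
    (hpend : ∀ v w : V, degR G v = 1 → G.Adj v w → degR G w ≠ 2) {v : V}
    (hv : v ∈ coreVerts G) : 2 ≤ coreCount G v := by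
  classical
  rw [mem_coreVerts] at hv
  have h1 := one_le_degR_of_adj (hadj v)
  have h2 := pendCount_le_one hadj hinv v
  have h3 := degR_eq_pendCount_add_coreCount (G := G) v
  by_cases h0 : pendCount G v = 0
  · omega
  · obtain ⟨u, hu⟩ := Finset.card_pos.1 (Nat.pos_of_ne_zero h0)
    simp only [Finset.mem_filter, Finset.mem_univ, true_and] at hu
    have := hpend u v hu.2 hu.1.symm
    omega

lemma coreCount_lt_card {v : V} (hv : v ∈ coreVerts G) :
    coreCount G v < (coreVerts G).card := by
  classical
  refine Finset.card_lt_card ⟨fun u hu => ?_, fun h => ?_⟩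
  · rw [mem_coreVerts]
    exact (Finset.mem_filter.1 hu).2.2
  · exact G.loopless.irrefl v (Finset.mem_filter.1 (h hv)).2.1

lemma sum_degR : ∑ v, degR G v = 2 * G.edgeSet.ncard := by
  classical
  have h := G.sum_degrees_eq_twice_card_edges
  rw [Set.ncard_eq_toFinset_card']
  simp only [degR_eq_degree]
  exact h

lemma sum_coreVerts_pendCount (hconn : G.Connected) (hcard : 2 < Fintype.card V) :
    ∑ v ∈ coreVerts G, pendCount G v + (coreVerts G).card = Fintype.card V := by
  classical
  have h1 : ∑ v ∈ coreVerts G, pendCount G v = ∑ v, pendCount G v := by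
    rw [coreVerts, Finset.sum_filter]
    refine Finset.sum_congr rfl fun v _ => ?_
    split_ifs with h
    · rfl
    · rw [pendCount_eq_zero hconn hcard (not_not.1 h)]
  have h2 : ∑ v, pendCount G v = (Finset.univ.filter fun v => degR G v = 1).card := by
    simp only [pendCount, Finset.card_filter]
    rw [Finset.sum_comm]
    refine Finset.sum_congr rfl fun u _ => ?_
    split_ifs with hu
    · rw [← hu, degR_eq_card_filter, Finset.card_filter]
      exact Finset.sum_congr rfl fun v _ => by simp [← degR_eq_card_filter, hu, G.adj_comm]
    · simp [hu]
  rw [h1, h2, coreVerts, Finset.card_filter_add_card_filter_not, Finset.card_univ]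

lemma sum_coreVerts_coreCount (hconn : G.Connected) (hcard : 2 < Fintype.card V) :
    ∑ v ∈ coreVerts G, coreCount G v + 2 * ∑ v ∈ coreVerts G, pendCount G v =
      2 * G.edgeSet.ncard := by
  classical
  have h1 := sum_coreVerts_pendCount hconn hcard
  have h2 : (Finset.univ.filter fun v => degR G v = 1).card + (coreVerts G).card =
      Fintype.card V := by
    rw [coreVerts, Finset.card_filter_add_card_filter_not, Finset.card_univ]
  have h3 := sum_degR (G := G)
  rw [← Finset.sum_filter_add_sum_filter_not _ (fun v => degR G v = 1),
    Finset.sum_congr rfl (g := fun _ => 1) (fun v hv => (Finset.mem_filter.1 hv).2),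
    Finset.sum_const, smul_eq_mul, mul_one] at h3
  change _ + ∑ v ∈ coreVerts G, degR G v = _ at h3
  simp only [degR_eq_pendCount_add_coreCount, Finset.sum_add_distrib] at h3 h2
  omega

lemma inv_sqrt_ge_tangent {x : ℝ} (hx : 0 < x) :
    9 / 16 - 27 / 1024 * x ≤ 1 / Real.sqrt x := by
  have ht := Real.sqrt_pos.2 hx
  have hsq := Real.sq_sqrt hx.le
  rw [le_div_iff₀ ht, ← hsq, Real.sqrt_sq ht.le]
  nlinarith [mul_nonneg (sq_nonneg (3 * Real.sqrt x / 8 - 1))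
    (by positivity : 0 ≤ 3 * Real.sqrt x / 8 + 2)]

/-- Pendent edges are kept exactly; every other edge is bounded below by a tangent line. -/
lemma sum_coreVerts_le_sumConn (hconn : G.Connected) (hcard : 2 < Fintype.card V) :
    ∑ v ∈ coreVerts G, ((pendCount G v : ℝ) * (1 / Real.sqrt (1 + degR G v)) +
      (coreCount G v : ℝ) * (9 / 32 - 27 / 1024 * degR G v)) ≤ sumConn G := by
  classical
  let A : V → V → ℝ := fun u v =>
    if G.Adj u v ∧ degR G v = 1 then 1 / Real.sqrt (1 + degR G u) else 0
  let B : V → V → ℝ := fun u v =>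
    if degR G u ≠ 1 then
      (if G.Adj u v ∧ degR G v ≠ 1 then 9 / 32 - 27 / 1024 * (degR G u : ℝ) else 0) else 0
  have hterm : ∀ u v, (A u v + B u v) + (A v u + B v u) ≤ if G.Adj u v then
      (1 : ℝ) / Real.sqrt ((degR G u : ℝ) + (degR G v : ℝ)) else 0 := by
    intro u v
    by_cases h : G.Adj u v
    · by_cases hu : degR G u = 1
      · have hv := degR_ne_one_of_adj hconn hcard h hu
        simp [A, B, h, h.symm, hu, hv]
      · by_cases hv : degR G v = 1
        · simp [A, B, h, h.symm, hu, hv, add_comm]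
        · have hpos : (0 : ℝ) < (degR G u : ℝ) + degR G v := by
            have : (1 : ℝ) ≤ degR G u := by exact_mod_cast one_le_degR_of_adj h
            positivity
          have := inv_sqrt_ge_tangent hpos
          simp only [A, B, h, h.symm, hu, hv, and_false, if_false, and_self, if_true, ne_eq,
            not_false_eq_true]
          linarith
    · have h' : ¬ G.Adj v u := fun h' => h h'.symm
      simp [A, B, h, h']
  have hsum : ∑ u, ∑ v, (A u v + B u v) =
      ∑ v ∈ coreVerts G, ((pendCount G v : ℝ) * (1 / Real.sqrt (1 + degR G v)) +
      (coreCount G v : ℝ) * (9 / 32 - 27 / 1024 * degR G v)) := by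
    rw [coreVerts, Finset.sum_filter]
    refine Finset.sum_congr rfl fun u _ => ?_
    have hA : ∑ v, A u v = (pendCount G u : ℝ) * (1 / Real.sqrt (1 + degR G u)) := by
      rw [← Finset.sum_filter, Finset.sum_const, nsmul_eq_mul, pendCount]
    rw [Finset.sum_add_distrib, hA]
    split_ifs with hu
    · congr 1
      simp only [B, if_pos hu]
      rw [← Finset.sum_filter, Finset.sum_const, nsmul_eq_mul, coreCount]
    · rw [pendCount_eq_zero hconn hcard (not_not.1 hu)]
      simp [B, hu]
  have hle := Finset.sum_le_sum fun u (_ : u ∈ Finset.univ) =>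
    Finset.sum_le_sum fun v (_ : v ∈ Finset.univ) => hterm u v
  rw [← two_mul_sumConn] at hle
  have hsymm : ∀ C : V → V → ℝ, ∑ u, ∑ v, (C u v + C v u) = 2 * ∑ u, ∑ v, C u v := by
    intro C
    simp only [Finset.sum_add_distrib]
    rw [Finset.sum_comm (f := fun u v => C v u)]
    ring
  rw [hsymm (fun u v => A u v + B u v), hsum] at hle
  linarith

end Core

/-- The excess of `v`: the number of its non-pendent neighbours beyond two. -/
noncomputable def excess {V : Type*} [Fintype V] (G : SimpleGraph V) (v : V) : ℕ :=
  coreCount G v - 2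

lemma sumConn_lower_bound {V : Type*} [Fintype V] {G : SimpleGraph V} {m p : ℕ}
    (hconn : G.Connected) (hcard : 2 < Fintype.card V)
    (hone : ∀ v, pendCount G v ≤ 1)
    (htwo : ∀ v ∈ coreVerts G, coreCount G v = excess G v + 2)
    (hp : ∑ v ∈ coreVerts G, pendCount G v = p) (hcore : p + (coreVerts G).card = 2 * m)
    (he : ∑ v ∈ coreVerts G, excess G v = 2) (κ : ℝ)
    (hκ : ∀ v ∈ coreVerts G, 1 / 2 - κ * excess G v ≤ 1 / Real.sqrt (4 + excess G v)) :
    (p : ℝ) / 2 - κ * ∑ v ∈ coreVerts G, (excess G v * pendCount G v : ℝ) +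
      9 / 16 * (2 * m + 1 - p) - 27 / 1024 * (8 * m - 2 * p + 8 +
      ∑ v ∈ coreVerts G, (excess G v : ℝ) ^ 2 +
      ∑ v ∈ coreVerts G, (excess G v * pendCount G v : ℝ)) ≤ sumConn G := by
  refine le_trans ?_ (sum_coreVerts_le_sumConn hconn hcard)
  have hp' : ∑ v ∈ coreVerts G, (pendCount G v : ℝ) = p := by exact_mod_cast hp
  have he' : ∑ v ∈ coreVerts G, (excess G v : ℝ) = 2 := by exact_mod_cast he
  have hc' : (p : ℝ) + (coreVerts G).card = 2 * m := by exact_mod_cast hcore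
  have hterm : ∀ v ∈ coreVerts G,
      1 / 2 * (pendCount G v : ℝ) - κ * (excess G v * pendCount G v) +
        9 / 32 * (excess G v + 2) - 27 / 1024 * ((excess G v : ℝ) ^ 2 + 4 * excess G v + 4 +
        excess G v * pendCount G v + 2 * pendCount G v) ≤
      (pendCount G v : ℝ) * (1 / Real.sqrt (1 + degR G v)) +
      (coreCount G v : ℝ) * (9 / 32 - 27 / 1024 * degR G v) := by
    intro v hv
    have hκv := hκ v hv
    have hone := hone v
    rw [degR_eq_pendCount_add_coreCount, htwo v hv]
    interval_cases h : pendCount G v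
    · push_cast
      nlinarith
    · push_cast
      rw [show (1 : ℝ) + (1 + ((excess G v : ℝ) + 2)) = 4 + excess G v by ring]
      nlinarith
  refine le_trans (le_of_eq ?_) (Finset.sum_le_sum hterm)
  simp only [Finset.sum_add_distrib, Finset.sum_sub_distrib, ← Finset.mul_sum, hp', he',
    Finset.sum_const, nsmul_eq_mul]
  linear_combination (-9 / 16 + 27 / 256 : ℝ) * hc'

section Extremal

variable {V : Type*} [Fintype V] {G : SimpleGraph V}

lemma adj_of_coreCount_add_one_eq {v w : V} (hv : v ∈ coreVerts G) (hw : w ∈ coreVerts G)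
    (hne : w ≠ v) (h : coreCount G v + 1 = (coreVerts G).card) : G.Adj v w := by
  classical
  have hsub : (Finset.univ.filter fun u => G.Adj v u ∧ degR G u ≠ 1) ⊆
      (coreVerts G).erase v := by
    intro u hu
    have hu' := (Finset.mem_filter.1 hu).2
    exact Finset.mem_erase.2 ⟨hu'.1.ne', mem_coreVerts.2 hu'.2⟩
  have heq := Finset.eq_of_subset_of_card_le hsub (by
    rw [Finset.card_erase_of_mem hv]
    change _ ≤ coreCount G v
    omega)
  have hmem : w ∈ (coreVerts G).erase v := Finset.mem_erase.2 ⟨hne, hw⟩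
  rw [← heq] at hmem
  exact (Finset.mem_filter.1 hmem).2.1

lemma one_le_pendCount {v u : V} (h : G.Adj v u) (hu : degR G u = 1) : 1 ≤ pendCount G v := by
  classical
  exact Finset.card_pos.2 ⟨u, by simp [h, hu]⟩

lemma exists_pendent_of_pendCount_ne_zero {v : V} (h : pendCount G v ≠ 0) :
    ∃ u, G.Adj v u ∧ degR G u = 1 := by
  classical
  obtain ⟨u, hu⟩ := Finset.card_pos.1 (Nat.pos_of_ne_zero h)
  exact ⟨u, (Finset.mem_filter.1 hu).2⟩

/-- On a core of four vertices, the two vertices of excess one cannot both carry a pendent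
vertex: the remaining two vertices would be matched to each other and be non-adjacent. -/
lemma not_sum_excess_mul_pendCount_eq_two {σ : V → V} (hadj : ∀ v, G.Adj v (σ v))
    (hinv : ∀ v, σ (σ v) = v)
    (htwo : ∀ v ∈ coreVerts G, coreCount G v = excess G v + 2)
    (hcore : (coreVerts G).card = 4)
    (hp : ∑ v ∈ coreVerts G, pendCount G v = 2)
    (he : ∑ v ∈ coreVerts G, excess G v = 2)
    (hle : ∀ v ∈ coreVerts G, excess G v ≤ 1) :
    ∑ v ∈ coreVerts G, excess G v * pendCount G v ≠ 2 := by
  classical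
  intro hB
  have hone := pendCount_le_one hadj hinv
  have h1 := (Finset.sum_eq_sum_iff_of_le (s := coreVerts G)
    (f := fun v => excess G v * pendCount G v) (g := fun v => excess G v)
    (fun v _ => mul_le_of_le_one_right (Nat.zero_le _) (hone v))).1 (hB.trans he.symm)
  have h2 := (Finset.sum_eq_sum_iff_of_le (s := coreVerts G)
    (f := fun v => excess G v * pendCount G v) (g := fun v => pendCount G v)
    (fun v hv => mul_le_of_le_one_left (Nat.zero_le _) (hle v hv))).1 (hB.trans hp.symm)
  have hes : ∀ v ∈ coreVerts G, excess G v = pendCount G v := fun v hv =>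
    (h1 v hv).symm.trans (h2 v hv)
  obtain ⟨c, hc, hc0⟩ : ∃ c ∈ coreVerts G, pendCount G c = 0 := by
    by_contra! hcon
    have : ∑ v ∈ coreVerts G, pendCount G v = ∑ v ∈ coreVerts G, 1 :=
      Finset.sum_congr rfl fun v hv => le_antisymm (hone v) (Nat.pos_of_ne_zero (hcon v hv))
    simp [hp, hcore] at this
  have hσ1 : degR G (σ c) ≠ 1 := fun h => by
    have := one_le_pendCount (hadj c) h
    omega
  have hσ0 : pendCount G (σ c) = 0 := by
    by_contra h
    obtain ⟨u, hu, hu1⟩ := exists_pendent_of_pendCount_ne_zero h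
    have h3 := eq_of_adj_of_degR_eq_one hu1 (hadj u) hu.symm
    have h4 : u = c := by rw [← hinv u, h3, hinv]
    exact mem_coreVerts.1 hc (h4 ▸ hu1)
  have hScard : ((coreVerts G).filter fun v => pendCount G v = 1).card = 2 := by
    rw [← hp, Finset.card_filter]
    refine Finset.sum_congr rfl fun v _ => ?_
    have := hone v
    interval_cases pendCount G v <;> rfl
  have hsub : insert (σ c) ((coreVerts G).filter fun v => pendCount G v = 1) ⊆
      Finset.univ.filter fun u => G.Adj c u ∧ degR G u ≠ 1 := by
    intro u hu
    rcases Finset.mem_insert.1 hu with rfl | hu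
    · simp [hadj c, hσ1]
    · obtain ⟨huC, hu1⟩ := Finset.mem_filter.1 hu
      have hne : c ≠ u := by
        rintro rfl
        omega
      have := adj_of_coreCount_add_one_eq huC hc hne (by rw [htwo u huC, hes u huC, hu1, hcore])
      simp [this.symm, mem_coreVerts.1 huC]
  have hcard := Finset.card_le_card hsub
  rw [Finset.card_insert_of_notMem (by simp [hσ0]), hScard] at hcard
  change 3 ≤ coreCount G c at hcard
  rw [htwo c hc, hes c hc, hc0] at hcard
  omega

lemma nonempty_iso_modelGraph {σ : V → V} (hadj : ∀ v, G.Adj v (σ v))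
    (hinv : ∀ v, σ (σ v) = v) (hcard : Fintype.card V = 6)
    (htwo : ∀ v ∈ coreVerts G, coreCount G v = excess G v + 2)
    (hcore : (coreVerts G).card = 5)
    (hp : ∑ v ∈ coreVerts G, pendCount G v = 1) {c : V} (hc : c ∈ coreVerts G)
    (hc2 : excess G c = 2) (hc1 : pendCount G c = 1)
    (h0 : ∀ v ∈ coreVerts G, v ≠ c → excess G v = 0) :
    Nonempty (G ≃g modelGraph) := by
  classical
  obtain ⟨u, hcu, hu1⟩ := exists_pendent_of_pendCount_ne_zero (by rw [hc1]; exact one_ne_zero)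
  have hσu : σ u = c := eq_of_adj_of_degR_eq_one hu1 (hadj u) hcu.symm
  have hσc : σ c = u := by rw [← hσu, hinv]
  have hccore : ∀ w ∈ coreVerts G, w ≠ c → G.Adj c w := fun w hw hne =>
    adj_of_coreCount_add_one_eq hc hw hne (by rw [htwo c hc, hc2, hcore])
  have hpend0 : ∀ v ∈ coreVerts G, v ≠ c → pendCount G v = 0 := by
    intro v hv hne
    have h := Finset.add_sum_erase (coreVerts G) (fun v => pendCount G v) hc
    have h3 := Finset.single_le_sum (f := fun v => pendCount G v) (s := (coreVerts G).erase c)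
      (fun _ _ => Nat.zero_le _) (Finset.mem_erase.2 ⟨hne, hv⟩)
    omega
  have hnotcore : ∀ w, w ∉ coreVerts G → w = u := by
    have h1 : (coreVerts G)ᶜ.card = 1 := by rw [Finset.card_compl, hcard, hcore]
    obtain ⟨x, hx⟩ := Finset.card_eq_one.1 h1
    have hux : u ∈ (coreVerts G)ᶜ := by simp [mem_coreVerts, hu1]
    intro w hw
    have hwx : w ∈ (coreVerts G)ᶜ := by simpa using hw
    rw [hx, Finset.mem_singleton] at hux hwx
    rw [hux, hwx]
  set R := (coreVerts G).erase c with hR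
  have hRcard : R.card = 4 := by rw [hR, Finset.card_erase_of_mem hc, hcore]
  have hRu : ∀ r ∈ R, r ≠ u := by
    rintro r hr rfl
    exact mem_coreVerts.1 (Finset.mem_of_mem_erase hr) hu1
  have hRc : ∀ r ∈ R, r ≠ c := fun r hr => Finset.ne_of_mem_erase hr
  have hσR : ∀ r ∈ R, σ r ∈ R := by
    intro r hr
    refine Finset.mem_erase.2 ⟨fun h => hRu r hr ?_, ?_⟩
    · rw [← hinv r, h, hσc]
    · by_contra h
      refine hRc r hr ?_
      rw [← hinv r, hnotcore _ h, hσu]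
  have hRadj : ∀ r ∈ R, ∀ w, G.Adj r w ↔ w = c ∨ w = σ r := by
    intro r hr
    have hrC := Finset.mem_of_mem_erase hr
    have hd : degR G r = 2 := by
      rw [degR_eq_pendCount_add_coreCount, htwo r hrC, h0 r hrC (hRc r hr),
        hpend0 r hrC (hRc r hr)]
    have hsub : ({c, σ r} : Finset V) ⊆ Finset.univ.filter fun w => G.Adj r w := by
      intro w hw
      simp only [Finset.mem_insert, Finset.mem_singleton] at hw
      rcases hw with rfl | rfl
      · simpa using (hccore r hrC (hRc r hr)).symm
      · simpa using hadj r
    have heq := Finset.eq_of_subset_of_card_le hsub (by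
      rw [← degR_eq_card_filter, hd, Finset.card_pair (hRc _ (hσR r hr)).symm])
    intro w
    have := Finset.ext_iff.1 heq w
    simpa using this.symm
  obtain ⟨a, ha⟩ : R.Nonempty := Finset.card_pos.1 (by omega)
  obtain ⟨b, hb⟩ : (R \ {a, σ a}).Nonempty := by
    refine Finset.card_pos.1 ?_
    have h1 := Finset.le_card_sdiff {a, σ a} R
    have h2 := Finset.card_le_two (a := a) (b := σ a)
    omega
  simp only [Finset.mem_sdiff, Finset.mem_insert, Finset.mem_singleton, not_or] at hb
  obtain ⟨hb, hba, hbσ⟩ := hb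
  have hσinj : ∀ x y, σ x = σ y → x = y := fun x y h => by rw [← hinv x, h, hinv]
  have hσb : σ b ≠ a := fun h => hbσ (by rw [← h, hinv])
  let f : Fin 6 → V := ![c, a, σ a, b, σ b, u]
  have hinj : Function.Injective f := by
    rw [← List.nodup_ofFn]
    have e1 := (hRc a ha).symm
    have e2 := (hRc _ (hσR a ha)).symm
    have e3 := (hRc b hb).symm
    have e4 := (hRc _ (hσR b hb)).symm
    have e5 := hcu.ne
    have e6 := (hadj a).ne
    have e7 := (hadj b).ne
    have e8 : σ a ≠ σ b := fun h => hba (hσinj _ _ h).symm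
    have e9 := hRu a ha
    have e10 := hRu _ (hσR a ha)
    have e11 := hRu b hb
    have e12 := hRu _ (hσR b hb)
    simp [f, e1, e2, e3, e4, e5, e6, e7, e8, e9, e10, e11, e12, Ne.symm hba, Ne.symm hbσ,
      hσb.symm]
  have hbij : Function.Bijective f :=
    (Fintype.bijective_iff_injective_and_card f).2 ⟨hinj, by simp [hcard]⟩
  have a0 : ∀ j, G.Adj c (f j) ↔ j ≠ 0 := by
    intro j
    have hj : j ≠ 0 ↔ f j ≠ c := hinj.ne_iff.symm
    rw [hj]
    refine ⟨fun h => h.ne', fun h => ?_⟩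
    by_cases hjC : f j ∈ coreVerts G
    · exact hccore _ hjC h
    · rw [hnotcore _ hjC]
      exact hcu
  have aR : ∀ r ∈ R, ∀ k, f k = σ r → ∀ j, G.Adj r (f j) ↔ j = 0 ∨ j = k := by
    intro r hr k hk j
    rw [hRadj r hr, ← hk, hinj.eq_iff]
    exact or_congr_left (hinj.eq_iff (b := 0))
  have a1 := aR a ha 2 rfl
  have a2 := aR _ (hσR a ha) 1 (hinv a).symm
  have a3 := aR b hb 4 rfl
  have a4 := aR _ (hσR b hb) 3 (hinv b).symm
  have a5 : ∀ j, G.Adj u (f j) ↔ j = 0 := by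
    intro j
    have hj : j = 0 ↔ f j = c := (hinj.eq_iff (b := 0)).symm
    rw [hj]
    exact ⟨fun h => eq_of_adj_of_degR_eq_one hu1 h hcu.symm, fun h => h ▸ hcu.symm⟩
  have key : ∀ i j, G.Adj (f i) (f j) ↔ modelAdj i j := by
    intro i j
    fin_cases i
    · exact (a0 j).trans (by revert j; decide)
    · exact (a1 j).trans (by revert j; decide)
    · exact (a2 j).trans (by revert j; decide)
    · exact (a3 j).trans (by revert j; decide)
    · exact (a4 j).trans (by revert j; decide)
    · exact (a5 j).trans (by revert j; decide)
  exact ⟨RelIso.symm ⟨Equiv.ofBijective f hbij, fun {i j} => key i j⟩⟩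

end Extremal

section Numerics

lemma le_one_div_sqrt {c x : ℝ} (hx : 0 < x) (h : c ^ 2 * x ≤ 1) : c ≤ 1 / Real.sqrt x := by
  rw [le_div_iff₀ (Real.sqrt_pos.2 hx)]
  refine le_of_abs_le (abs_le_of_sq_le_sq ?_ zero_le_one)
  rw [mul_pow, Real.sq_sqrt hx.le]
  simpa using h

lemma one_div_sqrt_le {c x : ℝ} (hc : 0 ≤ c) (hx : 0 < x) (h : 1 ≤ c ^ 2 * x) :
    1 / Real.sqrt x ≤ c := by
  rw [div_le_iff₀ (Real.sqrt_pos.2 hx)]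
  refine le_of_abs_le (abs_le_of_sq_le_sq ?_ (by positivity))
  rw [mul_pow, Real.sq_sqrt hx.le]
  simpa using h

lemma extremalValue_le_of_five_le {m : ℕ} (hm : 5 ≤ m) :
    ((m : ℝ) + 1) / Real.sqrt ((m : ℝ) + 4) + 1 / Real.sqrt ((m : ℝ) + 3) +
      ((m : ℝ) - 3) / Real.sqrt 3 + 1 ≤
    2 * (m + 4) / 9 + 0.354 + 0.5774 * (m - 3) + 1 := by
  have hm' : (5 : ℝ) ≤ m := by exact_mod_cast hm
  have h1 : ((m : ℝ) + 1) / Real.sqrt ((m : ℝ) + 4) ≤ 2 * (m + 4) / 9 := by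
    have hpos : (0 : ℝ) < m + 4 := by positivity
    have ht := Real.sqrt_pos.2 hpos
    have hsq := Real.sq_sqrt hpos.le
    rw [div_le_iff₀ ht]
    nlinarith [mul_nonneg (sq_nonneg (Real.sqrt ((m : ℝ) + 4) - 3))
      (by positivity : 0 ≤ 2 * Real.sqrt ((m : ℝ) + 4) + 3)]
  have h2 : 1 / Real.sqrt ((m : ℝ) + 3) ≤ 0.354 :=
    one_div_sqrt_le (by norm_num) (by positivity) (by nlinarith)
  have h3 : 1 / Real.sqrt (3 : ℝ) ≤ 0.5774 :=
    one_div_sqrt_le (by norm_num) (by norm_num) (by norm_num)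
  have h4 : ((m : ℝ) - 3) / Real.sqrt 3 ≤ 0.5774 * (m - 3) := by
    rw [div_eq_mul_one_div, mul_comm]
    exact mul_le_mul_of_nonneg_right h3 (by linarith)
  linarith

lemma extremalValue_four_le :
    (((4 : ℕ) : ℝ) + 1) / Real.sqrt (((4 : ℕ) : ℝ) + 4) + 1 / Real.sqrt (((4 : ℕ) : ℝ) + 3) +
      (((4 : ℕ) : ℝ) - 3) / Real.sqrt 3 + 1 ≤ 3.7235 := by
  have h1 : 1 / Real.sqrt (8 : ℝ) ≤ 0.35356 :=
    one_div_sqrt_le (by norm_num) (by norm_num) (by norm_num)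
  have h2 : 1 / Real.sqrt (7 : ℝ) ≤ 0.378 :=
    one_div_sqrt_le (by norm_num) (by norm_num) (by norm_num)
  have h3 : 1 / Real.sqrt (3 : ℝ) ≤ 0.5774 :=
    one_div_sqrt_le (by norm_num) (by norm_num) (by norm_num)
  rw [div_eq_mul_one_div]
  norm_num at *
  linarith

lemma extremalValue_three :
    (((3 : ℕ) : ℝ) + 1) / Real.sqrt (((3 : ℕ) : ℝ) + 4) + 1 / Real.sqrt (((3 : ℕ) : ℝ) + 3) +
      (((3 : ℕ) : ℝ) - 3) / Real.sqrt 3 + 1 = 4 / Real.sqrt 7 + 1 / Real.sqrt 6 + 1 := by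
  norm_num

lemma extremalValue_three_le : 4 / Real.sqrt 7 + 1 / Real.sqrt 6 + 1 ≤ 2.921 := by
  have h1 : 1 / Real.sqrt (7 : ℝ) ≤ 0.378 :=
    one_div_sqrt_le (by norm_num) (by norm_num) (by norm_num)
  have h2 : 1 / Real.sqrt (6 : ℝ) ≤ 0.4083 :=
    one_div_sqrt_le (by norm_num) (by norm_num) (by norm_num)
  rw [div_eq_mul_one_div]
  linarith

lemma half_sub_mul_le_of_le_two {e : ℕ} (he : e ≤ 2) :
    1 / 2 - (0.053 : ℝ) * e ≤ 1 / Real.sqrt (4 + e) := by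
  interval_cases e <;> exact le_one_div_sqrt (by norm_num) (by norm_num)

lemma half_sub_mul_le_of_eq_zero_or_two {e : ℕ} (he : e = 0 ∨ e = 2) :
    1 / 2 - (0.046 : ℝ) * e ≤ 1 / Real.sqrt (4 + e) := by
  rcases he with rfl | rfl <;> exact le_one_div_sqrt (by norm_num) (by norm_num)

end Numerics

/-- Away from `B_{6,3}`, the bound is strict. -/
lemma lt_sumConn_or_iso {V : Type*} [Fintype V] (G : SimpleGraph V) (m : ℕ) (hm : 3 ≤ m)
    (hcard : Fintype.card V = 2 * m) (hconn : G.Connected)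
    (hedges : G.edgeSet.ncard = 2 * m + 1) (hmatch : matchingNumber G = m)
    (hpend : ∀ v w : V, degR G v = 1 → G.Adj v w → degR G w ≠ 2) :
    ((m : ℝ) + 1) / Real.sqrt ((m : ℝ) + 4) + 1 / Real.sqrt ((m : ℝ) + 3) +
        ((m : ℝ) - 3) / Real.sqrt 3 + 1 < sumConn G ∨
      m = 3 ∧ Nonempty (G ≃g modelGraph) := by
  classical
  obtain ⟨σ, hadj, hinv⟩ := exists_matching_involution G m hcard hmatch
  have hV : 2 < Fintype.card V := by omega
  have hone := pendCount_le_one hadj hinv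
  have htwo : ∀ v ∈ coreVerts G, coreCount G v = excess G v + 2 := by
    intro v hv
    have := two_le_coreCount hadj hinv hpend hv
    rw [excess]
    omega
  obtain ⟨p, hp⟩ : ∃ p, ∑ v ∈ coreVerts G, pendCount G v = p := ⟨_, rfl⟩
  have hcore := sum_coreVerts_pendCount hconn hV
  have he := sum_coreVerts_coreCount hconn hV
  rw [hp, hcard] at hcore
  rw [hp, hedges, Finset.sum_congr rfl htwo, Finset.sum_add_distrib, Finset.sum_const,
    smul_eq_mul] at he
  replace he : ∑ v ∈ coreVerts G, excess G v = 2 := by omega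
  have hpm : p ≤ m := by
    have : p ≤ (coreVerts G).card := by
      rw [← hp]
      simpa using Finset.sum_le_card_nsmul (coreVerts G) _ 1 fun v _ => hone v
    omega
  have hexcess : ∀ v ∈ coreVerts G, excess G v + 2 < (coreVerts G).card := fun v hv => by
    rw [← htwo v hv]
    exact coreCount_lt_card hv
  have hle2 : ∀ v ∈ coreVerts G, excess G v ≤ 2 := fun v hv =>
    he ▸ Finset.single_le_sum (f := excess G) (fun _ _ => Nat.zero_le _) hv
  have hB2 : ∑ v ∈ coreVerts G, excess G v * pendCount G v ≤ 2 := by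
    refine le_trans (Finset.sum_le_sum fun v _ => ?_) he.le
    exact mul_le_of_le_one_right (Nat.zero_le _) (hone v)
  have bound := sumConn_lower_bound hconn hV hone htwo hp hcore he
  have castA : ∑ v ∈ coreVerts G, (excess G v : ℝ) ^ 2 =
      ((∑ v ∈ coreVerts G, excess G v ^ 2 : ℕ) : ℝ) := by push_cast; rfl
  have castB : ∑ v ∈ coreVerts G, (excess G v * pendCount G v : ℝ) =
      ((∑ v ∈ coreVerts G, excess G v * pendCount G v : ℕ) : ℝ) := by push_cast; rfl
  rw [castA, castB] at bound
  have hpmR : (p : ℝ) ≤ m := by exact_mod_cast hpm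
  by_cases hcase : ∃ c ∈ coreVerts G, 2 ≤ excess G c
  · obtain ⟨c, hc, hc2⟩ := hcase
    replace hc2 : excess G c = 2 := le_antisymm (hle2 c hc) hc2
    have h0 : ∀ v ∈ coreVerts G, v ≠ c → excess G v = 0 := by
      intro v hv hne
      have h := Finset.add_sum_erase (coreVerts G) (excess G) hc
      have h3 := Finset.single_le_sum (f := excess G) (s := (coreVerts G).erase c)
        (fun _ _ => Nat.zero_le _) (Finset.mem_erase.2 ⟨hne, hv⟩)
      omega
    have hA : ∑ v ∈ coreVerts G, excess G v ^ 2 = 4 := by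
      rw [Finset.sum_eq_single_of_mem c hc fun v hv hne => by simp [h0 v hv hne], hc2]
      rfl
    have hB : ∑ v ∈ coreVerts G, excess G v * pendCount G v = 2 * pendCount G c := by
      rw [Finset.sum_eq_single_of_mem c hc fun v hv hne => by simp [h0 v hv hne], hc2]
    have hcs := hexcess c hc
    have bound' := bound 0.046 fun v hv => half_sub_mul_le_of_eq_zero_or_two (by
      by_cases hvc : v = c
      · exact Or.inr (hvc ▸ hc2)
      · exact Or.inl (h0 v hv hvc))
    rw [hA] at bound'
    have hB2R : ((∑ v ∈ coreVerts G, excess G v * pendCount G v : ℕ) : ℝ) ≤ 2 := by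
      exact_mod_cast hB2
    rcases (by omega : m = 3 ∨ m = 4 ∨ 5 ≤ m) with rfl | rfl | hm5
    · rw [extremalValue_three]
      have hp1 : p ≤ 1 := by omega
      have hval := extremalValue_three_le
      by_cases hs : pendCount G c = 0
      · left
        rw [hB, hs] at bound'
        have hp1R : (p : ℝ) ≤ 1 := by exact_mod_cast hp1
        norm_num at bound' hval ⊢
        linarith
      · right
        have hs1 : pendCount G c = 1 := le_antisymm (hone c) (Nat.pos_of_ne_zero hs)
        have hp1' : pendCount G c ≤ p :=
          hp ▸ Finset.single_le_sum (f := pendCount G) (fun _ _ => Nat.zero_le _) hc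
        have hpe : p = 1 := le_antisymm hp1 (hs1 ▸ hp1')
        subst hpe
        exact ⟨rfl, nonempty_iso_modelGraph hadj hinv hcard htwo (by omega) hp hc hc2 hs1 h0⟩
    · left
      have hp1 : p ≤ 3 := by omega
      have hp1R : (p : ℝ) ≤ 3 := by exact_mod_cast hp1
      have hval := extremalValue_four_le
      norm_num at bound' hval hB2R ⊢
      linarith
    · left
      have hval := extremalValue_le_of_five_le hm5
      have hm5R : (5 : ℝ) ≤ m := by exact_mod_cast hm5
      norm_num at bound' hval hB2R ⊢
      linarith
  · left
    push Not at hcase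
    replace hcase : ∀ v ∈ coreVerts G, excess G v ≤ 1 := fun v hv =>
      Nat.le_of_lt_succ (hcase v hv)
    have hA : ∑ v ∈ coreVerts G, excess G v ^ 2 = 2 := by
      refine Eq.trans (Finset.sum_congr rfl fun v hv => ?_) he
      have := hcase v hv
      interval_cases excess G v <;> rfl
    have hBp1 : ∑ v ∈ coreVerts G, excess G v * pendCount G v ≤ p := by
      rw [← hp]
      exact Finset.sum_le_sum fun v hv => mul_le_of_le_one_left (Nat.zero_le _) (hcase v hv)
    have bound' := bound 0.053 fun v hv => half_sub_mul_le_of_le_two (hle2 v hv)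
    rw [hA] at bound'
    have hB2R : ((∑ v ∈ coreVerts G, excess G v * pendCount G v : ℕ) : ℝ) ≤ 2 := by
      exact_mod_cast hB2
    rcases (by omega : m = 3 ∨ m = 4 ∨ 5 ≤ m) with rfl | rfl | hm5
    · rw [extremalValue_three]
      obtain ⟨c, hc, hc0⟩ : ∃ c ∈ coreVerts G, excess G c ≠ 0 :=
        Finset.exists_ne_zero_of_sum_ne_zero (by rw [he]; exact two_ne_zero)
      have hcs := hexcess c hc
      have hp2 : p ≤ 2 := by omega
      have hB1 : ∑ v ∈ coreVerts G, excess G v * pendCount G v ≤ 1 := by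
        by_contra hcon
        have hpe : p = 2 := by omega
        subst hpe
        exact not_sum_excess_mul_pendCount_eq_two hadj hinv htwo (by omega) hp he hcase
          (by omega)
      have hB1R : ((∑ v ∈ coreVerts G, excess G v * pendCount G v : ℕ) : ℝ) ≤ 1 := by
        exact_mod_cast hB1
      have hp2R : (p : ℝ) ≤ 2 := by exact_mod_cast hp2
      have hval := extremalValue_three_le
      norm_num at bound' hval hB1R ⊢
      linarith
    · have hval := extremalValue_four_le
      have hp4R : (p : ℝ) ≤ 4 := by exact_mod_cast hpm
      norm_num at bound' hval hB2R ⊢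
      linarith
    · have hval := extremalValue_le_of_five_le hm5
      have hm5R : (5 : ℝ) ≤ m := by exact_mod_cast hm5
      norm_num at bound' hval hB2R ⊢
      linarith

/-- Let `G` be a bicyclic graph with `2m` vertices and matching number `m` (`m ≥ 3`),
such that no pendent vertex of `G` has a neighbor of degree two. Then
`χ(G) ≥ (m+1)/√(m+4) + 1/√(m+3) + (m−3)/√3 + 1`, with equality if and only if
`m = 3` and `G ≅ B_{6,3}`. -/
theorem stmt_3 {V : Type*} [Fintype V] (G : SimpleGraph V) (m : ℕ) (hm : 3 ≤ m)
    (hcard : Fintype.card V = 2 * m) (hconn : G.Connected)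
    (hedges : G.edgeSet.ncard = 2 * m + 1)
    (hmatch : matchingNumber G = m)
    (hpend : ∀ v w : V, degR G v = 1 → G.Adj v w → degR G w ≠ 2) :
    sumConn G ≥ ((m : ℝ) + 1) / Real.sqrt ((m : ℝ) + 4) + 1 / Real.sqrt ((m : ℝ) + 3) +
        ((m : ℝ) - 3) / Real.sqrt 3 + 1 ∧
    (sumConn G = ((m : ℝ) + 1) / Real.sqrt ((m : ℝ) + 4) + 1 / Real.sqrt ((m : ℝ) + 3) +
        ((m : ℝ) - 3) / Real.sqrt 3 + 1 ↔
      m = 3 ∧ Nonempty (G ≃g BnmGraph 6 3)) := by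
  have heq : m = 3 ∧ Nonempty (G ≃g BnmGraph 6 3) → sumConn G =
      ((m : ℝ) + 1) / Real.sqrt ((m : ℝ) + 4) + 1 / Real.sqrt ((m : ℝ) + 3) +
        ((m : ℝ) - 3) / Real.sqrt 3 + 1 := by
    rintro ⟨rfl, ⟨φ⟩⟩
    rw [sumConn_iso G (φ.trans bnmIsoModel), sumConn_modelGraph, extremalValue_three]
  rcases lt_sumConn_or_iso G m hm hcard hconn hedges hmatch hpend with hlt | ⟨hm3, ⟨φ⟩⟩
  · exact ⟨hlt.le, fun h => absurd h hlt.ne', heq⟩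
  · have hiso : m = 3 ∧ Nonempty (G ≃g BnmGraph 6 3) := ⟨hm3, ⟨φ.trans bnmIsoModel.symm⟩⟩
    exact ⟨(heq hiso).ge, fun _ => hiso, heq⟩
end
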